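/- (Consistency relation of the rank-2 quantum cluster scattering diagram of type B₂.) In the completed quantum plane A₂ (so Y₂Y₁ = v⁴·Y₁Y₂, with v playing the role of q^{1/2}), the identity Ψ_v(Y₂) · Ψ_{v²}(Y₁) = Ψ_{v²}(Y₁) · Ψ_v(y^{(1,1)}) · Ψ_{v²}(y^{(1,2)}) · Ψ_v(Y₂) holds, where y^{(1,1)} = v²·Y₁Y₂ and y^{(1,2)} = v⁴·Y₁Y₂². (This is the relation Ψ_{1/2}[e₂]Ψ_{1}[e₁] = Ψ_{1}[e₁]Ψ_{1/2}[(1,1)]Ψ_{1}[(1,2)]Ψ_{1/2}[(0,1)] for the type B₂ QCSD with (δ₁,δ₂) = (1,2), rendered in the quantum torus.) -/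

import Mathlib

noncomputable section

open Filter

abbrev K : Type := RatFunc ℚ

/-- The indeterminate generator `v` of `K = ℚ(v)`. -/
def v : K := RatFunc.X

/-- The completed quantum plane: formal series `Σ c_{m,n}·Y₁^m Y₂^n`, encoded as
coefficient functions `ℕ × ℕ → K`. -/
abbrev QP : Type := (ℕ × ℕ) → K

/-- The twisted product of the completed quantum plane `A_γ`:
`(Y₁^a Y₂^b)·(Y₁^{a'} Y₂^{b'}) = v^{2γba'}·Y₁^{a+a'} Y₂^{b+b'}`, extended bilinearly and
continuously for the coefficientwise topology. -/
def qmul (γ : ℕ) (F G : QP) : QP := fun p =>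
  ∑ a ∈ Finset.range (p.1 + 1), ∑ b ∈ Finset.range (p.2 + 1),
    v ^ (2 * γ * b * (p.1 - a)) * F (a, b) * G (p.1 - a, p.2 - b)

/-- The multiplicative unit of the completed quantum plane. -/
def qone : QP := fun p => if p = (0, 0) then 1 else 0

/-- Powers in the completed quantum plane. -/
def qpow (γ : ℕ) (Z : QP) : ℕ → QP
  | 0 => qone
  | k + 1 => qmul γ Z (qpow γ Z k)

/-- The element `v^β · y^{(m,n)} = v^{β + γmn} · Y₁^m Y₂^n` of `A_γ`
(`y^{(m,n)} := v^{γmn}·Y₁^m Y₂^n` is the normalized quantum monomial). -/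
def qy (γ : ℕ) (β : ℤ) (m n : ℕ) : QP := fun p =>
  if p = (m, n) then v ^ (β + (γ : ℤ) * (m : ℤ) * (n : ℤ)) else 0

/-- The series `Σ_{j≥1} ((−1)^{j+1}/(j·(w^j − w^{−j})))·Z^j` (for `Z` with zero
constant term, the coefficient at `(m,n)` only involves `j ≤ m + n`). -/
def qarg (γ : ℕ) (w : K) (Z : QP) : QP := fun r =>
  ∑ j ∈ Finset.Icc 1 (r.1 + r.2),
    ((-1 : K) ^ (j + 1) / ((j : K) * (w ^ j - w⁻¹ ^ j))) * qpow γ Z j r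

/-- The quantum dilogarithm `Ψ_w(Z) = exp(Σ_{j≥1} ((−1)^{j+1}/(j(w^j − w^{−j})))·Z^j)`
in `A_γ`, for `Z` with zero constant term. -/
def qPsi (γ : ℕ) (w : K) (Z : QP) : QP := fun p =>
  ∑ k ∈ Finset.range (p.1 + p.2 + 1),
    ((Nat.factorial k : K)⁻¹) * qpow γ (qarg γ w Z) k p

/-- The ordered product `→∏_{p=a..b} g_p = g_a g_{a+1} ⋯ g_b` in `A_γ`. -/
def qprodR (γ : ℕ) (g : ℕ → QP) (a b : ℕ) : QP :=
  ((List.range' a (b + 1 - a)).map g).foldr (qmul γ) qone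

/-- The ordered product `←∏_{p=a..b} g_p = g_b ⋯ g_{a+1} g_a` in `A_γ`. -/
def qprodL (γ : ℕ) (g : ℕ → QP) (a b : ℕ) : QP :=
  ((List.range' a (b + 1 - a)).reverse.map g).foldr (qmul γ) qone

namespace PowerSeries

variable {F : Type*} [Field F]

theorem derivative_rescale (a : F) (f : PowerSeries F) :
    derivative F (rescale a f) = C a * rescale a (derivative F f) := by
  ext n
  simp only [coeff_derivative, coeff_rescale, coeff_C_mul]
  ring

/-- Uniqueness of the solution of a first order linear differential equation with prescribed
nonzero constant term. -/
theorem eq_of_derivative_eq_mul [CharZero F] {f g h : PowerSeries F}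
    (hf : derivative F f = h * f) (hg : derivative F g = h * g)
    (hc : constantCoeff f = constantCoeff g) (h0 : constantCoeff g ≠ 0) : f = g := by
  have hgi : g * g⁻¹ = 1 := PowerSeries.mul_inv_cancel g h0
  have key : f * g⁻¹ = 1 := by
    refine derivative.ext ?_ ?_
    · rw [Derivation.leibniz, derivative_inv', hf, hg, Derivation.map_one_eq_zero, smul_eq_mul,
        smul_eq_mul]
      linear_combination (-(f * g⁻¹ * h)) * hgi
    · rw [map_mul, hc, ← map_mul, hgi]
  calc f = f * (g * g⁻¹) := by rw [hgi, mul_one]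
    _ = f * g⁻¹ * g := by ring
    _ = g := by rw [key, one_mul]

/-- The logarithm of the quantum dilogarithm. -/
def dilogExponent (w : F) : PowerSeries F :=
  mk fun j => (-1 : F) ^ (j + 1) / ((j : F) * (w ^ j - w⁻¹ ^ j))

theorem hasSubst_dilogExponent (w : F) : HasSubst (dilogExponent w) :=
  HasSubst.of_constantCoeff_zero' (by
    rw [← coeff_zero_eq_constantCoeff_apply]; simp [dilogExponent])

/-- The quantum dilogarithm as a power series in one variable. -/
def dilog [CharZero F] (w : F) : PowerSeries F :=
  letI := DivisionRing.toRatAlgebra (R := F)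
  (exp F).subst (dilogExponent w)

theorem coeff_dilog [CharZero F] (w : F) {n N : ℕ} (h : n < N) :
    coeff n (dilog w) = ∑ k ∈ Finset.range N, (Nat.factorial k : F)⁻¹ *
      coeff n (dilogExponent w ^ k) := by
  rw [dilog, coeff_subst' (hasSubst_dilogExponent w), finsum_eq_sum_of_support_subset]
  · refine Finset.sum_congr rfl fun k _ => ?_
    simp [coeff_exp]
  · intro k hk
    simp only [Finset.coe_range, Set.mem_Iio]
    by_contra hkN
    refine hk ?_
    have hX : X ∣ dilogExponent w := by
      rw [X_dvd_iff, ← coeff_zero_eq_constantCoeff_apply]; simp [dilogExponent]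
    have := X_pow_dvd_iff.1 (pow_dvd_pow_of_dvd hX k) n (by omega)
    simp [this]

theorem constantCoeff_dilog [CharZero F] (w : F) : constantCoeff (dilog w) = 1 := by
  rw [← coeff_zero_eq_constantCoeff_apply, coeff_dilog w (Nat.zero_lt_one)]
  simp

theorem derivative_dilog [CharZero F] (w : F) :
    derivative F (dilog w) = derivative F (dilogExponent w) * dilog w := by
  rw [dilog, derivative_subst (hasSubst_dilogExponent w), derivative_exp, mul_comm]

theorem rescale_dilog [CharZero F] {w : F} (hw : ∀ n : ℕ, w ^ (n + 1) ≠ w⁻¹ ^ (n + 1)) :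
    rescale w (dilog w) = (1 + X) * rescale w⁻¹ (dilog w) := by
  have hgeo : (1 + X) * (mk fun n => (-1 : F) ^ n) = 1 := by
    ext n
    rw [add_mul, one_mul, map_add]
    cases n with
    | zero => simp
    | succ n => simp [coeff_succ_X_mul, coeff_one, pow_succ]
  have hL : derivative F (rescale w (dilogExponent w)) =
      (mk fun n => (-1 : F) ^ n) + derivative F (rescale w⁻¹ (dilogExponent w)) := by
    ext n
    simp only [map_add, coeff_derivative, coeff_rescale, dilogExponent, coeff_mk]
    have h1 := sub_ne_zero.2 (hw n)
    have h2 : (n : F) + 1 ≠ 0 := Nat.cast_add_one_ne_zero n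
    generalize w ^ (n + 1) = a at *
    generalize w⁻¹ ^ (n + 1) = b at *
    push_cast
    field_simp
    ring
  have hd : ∀ a : F, derivative F (rescale a (dilog w)) =
      derivative F (rescale a (dilogExponent w)) * rescale a (dilog w) := by
    intro a
    rw [derivative_rescale, derivative_rescale, derivative_dilog, map_mul, mul_assoc]
  have hc : ∀ a : F, constantCoeff (rescale a (dilog w)) = 1 := by
    intro a
    rw [← coeff_zero_eq_constantCoeff_apply, coeff_rescale, coeff_zero_eq_constantCoeff_apply,
      constantCoeff_dilog, pow_zero, one_mul]
  refine eq_of_derivative_eq_mul (hd w) ?_ ?_ ?_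
  · rw [Derivation.leibniz, hd, hL, map_add, Derivation.map_one_eq_zero, derivative_X]
    simp only [smul_eq_mul]
    linear_combination (-rescale w⁻¹ (dilog w)) * hgeo
  · simp [hc]
  · simp [hc]

/-- The functional equation of the quantum dilogarithm. -/
theorem rescale_sq_dilog [CharZero F] {w : F} (hw : ∀ n : ℕ, w ^ (n + 1) ≠ w⁻¹ ^ (n + 1))
    (h0 : w ≠ 0) : rescale (w ^ 2) (dilog w) = (1 + C w * X) * dilog w := by
  have := congrArg (rescale w) (rescale_dilog hw)
  rwa [map_mul, map_add, map_one, rescale_X, rescale_rescale, rescale_rescale,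
    inv_mul_cancel₀ h0, rescale_one, RingHom.id_apply, ← sq] at this

end PowerSeries

open Finset.HasAntidiagonal (antidiagonal mem_antidiagonal)

theorem v_ne_zero : v ≠ 0 := RatFunc.X_ne_zero

/-- Reassociation of a double sum over antidiagonals. -/
theorem sum_antidiagonal_assoc {M : Type*} [AddCommMonoid M] (n : ℕ) (F : ℕ → ℕ → ℕ → M) :
    ∑ x ∈ antidiagonal n, ∑ y ∈ antidiagonal x.1, F y.1 y.2 x.2 =
      ∑ x ∈ antidiagonal n, ∑ y ∈ antidiagonal x.2, F x.1 y.1 y.2 := by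
  simp only [Finset.sum_sigma']
  apply Finset.sum_nbij' (fun ⟨⟨_i, j⟩, ⟨k, l⟩⟩ ↦ ⟨(k, l + j), (l, j)⟩)
    (fun ⟨⟨i, _j⟩, ⟨k, l⟩⟩ ↦ ⟨(i + k, l), (i, k)⟩) <;>
    simp +contextual [Sigma.forall, ← add_assoc]
  rintro a b c d rfl rfl
  exact add_assoc a c d

/-- The completed quantum plane with its ring structure. -/
def QuantumPlane (_γ : ℕ) : Type := QP

namespace QuantumPlane

variable {γ : ℕ}

instance : AddCommGroup (QuantumPlane γ) := inferInstanceAs (AddCommGroup QP)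

instance : Module K (QuantumPlane γ) := inferInstanceAs (Module K QP)

/-- The element of the completed quantum plane with given coefficients. -/
def ofQP (f : QP) : QuantumPlane γ := f

/-- The coefficient of `Y₁^m Y₂^n`. -/
def coeff (p : ℕ × ℕ) : QuantumPlane γ →ₗ[K] K where
  toFun f := (f : QP) p
  map_add' _ _ := rfl
  map_smul' _ _ := rfl

@[simp]
theorem coeff_ofQP (f : QP) (p : ℕ × ℕ) : coeff p (ofQP f : QuantumPlane γ) = f p := rfl

theorem ofQP_injective : Function.Injective (ofQP : QP → QuantumPlane γ) := fun _ _ h => h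

instance : Mul (QuantumPlane γ) := ⟨fun f g => ofQP (qmul γ f g)⟩

instance : One (QuantumPlane γ) := ⟨ofQP qone⟩

theorem ofQP_qmul (f g : QP) : (ofQP (qmul γ f g) : QuantumPlane γ) = ofQP f * ofQP g := rfl

@[ext]
theorem ext {f g : QuantumPlane γ} (h : ∀ a b, coeff (a, b) f = coeff (a, b) g) : f = g :=
  funext fun p => h p.1 p.2

theorem coeff_one (p : ℕ × ℕ) :
    coeff p (1 : QuantumPlane γ) = if p = (0, 0) then 1 else 0 := rfl

theorem coeff_mul (f g : QuantumPlane γ) (a b : ℕ) : coeff (a, b) (f * g) =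
    ∑ x ∈ antidiagonal a, ∑ y ∈ antidiagonal b,
      v ^ (2 * γ * y.1 * x.2) * coeff (x.1, y.1) f * coeff (x.2, y.2) g := by
  rw [Finset.Nat.sum_antidiagonal_eq_sum_range_succ_mk]
  simp only [Finset.Nat.sum_antidiagonal_eq_sum_range_succ_mk]
  rfl

protected theorem mul_assoc (f g h : QuantumPlane γ) : f * g * h = f * (g * h) := by
  ext a b
  simp only [coeff_mul, Finset.mul_sum, Finset.sum_mul]
  have key := sum_antidiagonal_assoc a fun x₁ x₂ x₃ => ∑ y ∈ antidiagonal b,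
    ∑ y' ∈ antidiagonal y.1, v ^ (2 * γ * (y'.1 * x₂ + (y'.1 + y'.2) * x₃)) *
      coeff (x₁, y'.1) f * coeff (x₂, y'.2) g * coeff (x₃, y.2) h
  refine Eq.trans (Finset.sum_congr rfl fun x _ => ?_) (key.trans
    (Finset.sum_congr rfl fun x hx => ?_))
  · rw [Finset.sum_comm]
    refine Finset.sum_congr rfl fun x' _ => Finset.sum_congr rfl fun y _ =>
      Finset.sum_congr rfl fun y' hy' => ?_
    rw [← mem_antidiagonal.1 hy']
    ring
  · refine Eq.trans ?_ Finset.sum_comm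
    refine Finset.sum_congr rfl fun x' hx' => ?_
    have key' := sum_antidiagonal_assoc b fun y₁ y₂ y₃ =>
      v ^ (2 * γ * (y₁ * x'.1 + (y₁ + y₂) * x'.2)) *
        coeff (x.1, y₁) f * coeff (x'.1, y₂) g * coeff (x'.2, y₃) h
    refine key'.trans (Finset.sum_congr rfl fun y _ => Finset.sum_congr rfl fun y' _ => ?_)
    rw [← mem_antidiagonal.1 hx']
    ring

protected theorem one_mul (f : QuantumPlane γ) : 1 * f = f := by
  ext a b
  rw [coeff_mul, Finset.sum_eq_single (0, a), Finset.sum_eq_single (0, b)]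
  · simp [coeff_one]
  · rintro ⟨x, y⟩ h hne
    have : x ≠ 0 := by
      rintro rfl
      simp_all
    simp [coeff_one, this]
  · simp
  · rintro ⟨x, y⟩ h hne
    have : x ≠ 0 := by
      rintro rfl
      simp_all
    simp [coeff_one, this]
  · simp

protected theorem mul_one (f : QuantumPlane γ) : f * 1 = f := by
  ext a b
  rw [coeff_mul, Finset.sum_eq_single (a, 0), Finset.sum_eq_single (b, 0)]
  · simp [coeff_one]
  · rintro ⟨x, y⟩ h hne
    have : y ≠ 0 := by
      rintro rfl
      simp_all
    simp [coeff_one, this]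
  · simp
  · rintro ⟨x, y⟩ h hne
    have : y ≠ 0 := by
      rintro rfl
      simp_all
    simp [coeff_one, this]
  · simp

instance : Ring (QuantumPlane γ) where
  __ : AddCommGroup (QuantumPlane γ) := inferInstance
  left_distrib f g h := by
    ext a b; simp only [coeff_mul, map_add, mul_add, Finset.sum_add_distrib]
  right_distrib f g h := by
    ext a b; simp only [coeff_mul, map_add, mul_add, add_mul, Finset.sum_add_distrib]
  zero_mul f := by ext a b; simp [coeff_mul]
  mul_zero f := by ext a b; simp [coeff_mul]
  mul_assoc := QuantumPlane.mul_assoc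
  one_mul := QuantumPlane.one_mul
  mul_one := QuantumPlane.mul_one

instance : IsScalarTower K (QuantumPlane γ) (QuantumPlane γ) where
  smul_assoc c f g := by
    ext a b
    simp only [smul_eq_mul, coeff_mul, map_smul, Finset.mul_sum]
    exact Finset.sum_congr rfl fun _ _ => Finset.sum_congr rfl fun _ _ => by ring

instance : SMulCommClass K (QuantumPlane γ) (QuantumPlane γ) where
  smul_comm c f g := by
    ext a b
    simp only [smul_eq_mul, coeff_mul, map_smul, Finset.mul_sum]
    exact Finset.sum_congr rfl fun _ _ => Finset.sum_congr rfl fun _ _ => by ring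

theorem ofQP_qpow (Z : QP) (k : ℕ) : (ofQP (qpow γ Z k) : QuantumPlane γ) = ofQP Z ^ k := by
  induction k with
  | zero => rfl
  | succ k ih => rw [pow_succ', qpow, ofQP_qmul, ih]

/-- The unnormalized monomial `Y₁^m Y₂^n`. -/
def mon (e : ℕ × ℕ) : QuantumPlane γ := ofQP fun p => if p = e then 1 else 0

theorem coeff_mon (e p : ℕ × ℕ) :
    coeff p (mon e : QuantumPlane γ) = if p = e then 1 else 0 := rfl

theorem mon_mul_mon (d e : ℕ × ℕ) :
    (mon d * mon e : QuantumPlane γ) = v ^ (2 * γ * d.2 * e.1) • mon (d + e) := by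
  ext a b
  rw [coeff_mul, map_smul, smul_eq_mul, coeff_mon, ← Finset.sum_product']
  by_cases h : (a, b) = d + e
  · obtain ⟨rfl, rfl⟩ := Prod.ext_iff.1 h
    rw [if_pos h, Finset.sum_eq_single ((d.1, e.1), (d.2, e.2))]
    · simp [coeff_mon]
    · rintro ⟨⟨x, x'⟩, y, y'⟩ hxy hne
      simp only [coeff_mon]
      split_ifs with h1 h2
      · exact absurd (by rw [← h1, ← h2]) hne
      all_goals simp
    · simp
  · rw [if_neg h, mul_zero, Finset.sum_eq_zero]
    rintro ⟨⟨x, x'⟩, y, y'⟩ hxy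
    simp only [coeff_mon]
    split_ifs with h1 h2
    · refine absurd ?_ h
      simp only [Finset.mem_product, mem_antidiagonal] at hxy
      rw [← h1, ← h2, ← hxy.1, ← hxy.2]
      rfl
    all_goals simp

/-- Rescaling of the two generators. -/
def twist (s t : K) (f : QuantumPlane γ) : QuantumPlane γ :=
  ofQP fun p => s ^ p.1 * t ^ p.2 * coeff p f

theorem coeff_twist (s t : K) (f : QuantumPlane γ) (p : ℕ × ℕ) :
    coeff p (twist s t f) = s ^ p.1 * t ^ p.2 * coeff p f := rfl

theorem twist_mul (s t : K) (f g : QuantumPlane γ) :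
    twist s t (f * g) = twist s t f * twist s t g := by
  ext a b
  simp only [coeff_mul, coeff_twist, Finset.mul_sum]
  refine Finset.sum_congr rfl fun x hx => Finset.sum_congr rfl fun y hy => ?_
  rw [← mem_antidiagonal.1 hx, ← mem_antidiagonal.1 hy]
  ring

theorem mul_mon (f : QuantumPlane γ) (e : ℕ × ℕ) :
    f * mon e = mon e * twist (v ^ (2 * γ * e.2))⁻¹ (v ^ (2 * γ * e.1)) f := by
  ext a b
  rw [coeff_mul, coeff_mul, ← Finset.Nat.sum_antidiagonal_swap]
  refine Finset.sum_congr rfl fun x _ => ?_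
  rw [← Finset.Nat.sum_antidiagonal_swap]
  refine Finset.sum_congr rfl fun y _ => ?_
  simp only [Prod.fst_swap, Prod.snd_swap, coeff_mon, coeff_twist]
  split_ifs with h
  · have hv : (v ^ (2 * γ * e.2)) ^ x.2 ≠ 0 := pow_ne_zero _ (pow_ne_zero _ v_ne_zero)
    rw [← h] at hv ⊢
    rw [inv_pow, mul_one, mul_one, pow_mul _ _ x.2, ← pow_mul _ _ y.2, mul_right_comm _ y.2]
    field_simp
  · simp

/-- The image of a one-variable power series under the substitution of `y^d`. -/
def ray (γ : ℕ) (d : ℕ × ℕ) (f : PowerSeries K) : QuantumPlane γ := ofQP fun p =>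
  if p = ((p.1 + p.2) / (d.1 + d.2) * d.1, (p.1 + p.2) / (d.1 + d.2) * d.2) then
    v ^ (γ * p.1 * p.2) * PowerSeries.coeff ((p.1 + p.2) / (d.1 + d.2)) f else 0

theorem coeff_ray {d : ℕ × ℕ} (hd : 0 < d.1 + d.2) (f : PowerSeries K) (k : ℕ) :
    coeff (k * d.1, k * d.2) (ray γ d f) =
      v ^ (γ * (k * d.1) * (k * d.2)) * PowerSeries.coeff k f := by
  have : (k * d.1 + k * d.2) / (d.1 + d.2) = k := by
    rw [← mul_add, Nat.mul_div_cancel _ hd]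
  simp [ray, this]

theorem coeff_ray_of_ne {d p : ℕ × ℕ} (f : PowerSeries K)
    (hp : ∀ k, p ≠ (k * d.1, k * d.2)) : coeff p (ray γ d f) = 0 :=
  if_neg (hp _)

theorem ray_add (d : ℕ × ℕ) (f g : PowerSeries K) : ray γ d (f + g) = ray γ d f + ray γ d g := by
  ext a b
  simp only [ray, coeff_ofQP, map_add]
  split_ifs <;> ring

theorem ray_C_mul (d : ℕ × ℕ) (c : K) (f : PowerSeries K) :
    ray γ d (PowerSeries.C c * f) = c • ray γ d f := by
  ext a b
  simp only [ray, coeff_ofQP, map_smul, smul_eq_mul, PowerSeries.coeff_C_mul]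
  split_ifs <;> ring

theorem ray_one {d : ℕ × ℕ} (hd : 0 < d.1 + d.2) : ray γ d 1 = 1 := by
  ext a b
  by_cases h : ∃ k, (a, b) = (k * d.1, k * d.2)
  · obtain ⟨k, hk⟩ := h
    rw [hk, coeff_ray hd, coeff_one, PowerSeries.coeff_one]
    rcases eq_or_ne k 0 with rfl | hk0
    · simp
    · have : ¬ (d.1 = 0 ∧ d.2 = 0) := by omega
      simpa [hk0] using this
  · push Not at h
    rw [coeff_ray_of_ne _ h, coeff_one, if_neg]
    simpa using h 0

theorem ray_X {d : ℕ × ℕ} (hd : 0 < d.1 + d.2) :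
    ray γ d PowerSeries.X = v ^ (γ * d.1 * d.2) • mon d := by
  ext a b
  by_cases h : ∃ k, (a, b) = (k * d.1, k * d.2)
  · obtain ⟨k, hk⟩ := h
    rw [hk, coeff_ray hd, map_smul, smul_eq_mul, coeff_mon, PowerSeries.coeff_X]
    rcases eq_or_ne k 1 with rfl | hk1
    · simp
    · rw [if_neg hk1, if_neg, mul_zero, mul_zero]
      rw [Prod.ext_iff]
      rintro ⟨h1, h2⟩
      refine hk1 (Nat.eq_of_mul_eq_mul_right hd ?_)
      simp only at h1 h2
      rw [mul_add, h1, h2, one_mul]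
  · push Not at h
    rw [coeff_ray_of_ne _ h, map_smul, smul_eq_mul, coeff_mon, if_neg, mul_zero]
    simpa using h 1

theorem ray_mul {d : ℕ × ℕ} (hd : 0 < d.1 + d.2) (f g : PowerSeries K) :
    ray γ d (f * g) = ray γ d f * ray γ d g := by
  ext a b
  rw [coeff_mul, ← Finset.sum_product']
  have hzero : ∀ x y : ℕ × ℕ, (∀ i j, (x.1, y.1) = (i * d.1, i * d.2) →
      (x.2, y.2) ≠ (j * d.1, j * d.2)) →
      v ^ (2 * γ * y.1 * x.2) * coeff (x.1, y.1) (ray γ d f) * coeff (x.2, y.2) (ray γ d g) = 0 := by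
    intro x y hxy
    by_cases hi : ∃ i, (x.1, y.1) = (i * d.1, i * d.2)
    · obtain ⟨i, hi⟩ := hi
      rw [coeff_ray_of_ne g fun j => hxy i j hi, mul_zero]
    · push Not at hi
      rw [coeff_ray_of_ne f hi, mul_zero, zero_mul]
  by_cases h : ∃ k, (a, b) = (k * d.1, k * d.2)
  · obtain ⟨k, hk⟩ := h
    obtain ⟨rfl, rfl⟩ := Prod.ext_iff.1 hk
    rw [coeff_ray hd, PowerSeries.coeff_mul, Finset.mul_sum]
    refine Finset.sum_of_injOn (fun i => ((i.1 * d.1, i.2 * d.1), (i.1 * d.2, i.2 * d.2)))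
      ?_ ?_ ?_ ?_
    · rintro ⟨i, j⟩ _ ⟨i', j'⟩ _ hij
      simp only [Prod.mk.injEq] at hij
      obtain ⟨⟨h1, h2⟩, h3, h4⟩ := hij
      have h5 : i = i' := Nat.eq_of_mul_eq_mul_right hd (by rw [mul_add, mul_add, h1, h3])
      have h6 : j = j' := Nat.eq_of_mul_eq_mul_right hd (by rw [mul_add, mul_add, h2, h4])
      rw [h5, h6]
    · rintro ⟨i, j⟩ hij
      simp only [Finset.coe_product, Set.mem_prod, Finset.mem_coe, mem_antidiagonal] at *
      simp [← hij, add_mul]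
    · rintro ⟨⟨x1, x2⟩, y1, y2⟩ hxy hnot
      simp only [Finset.mem_product, mem_antidiagonal] at hxy
      refine hzero _ _ fun i j hi hj => hnot ⟨(i, j), ?_, ?_⟩
      · simp only [Prod.mk.injEq] at hi hj
        rw [Finset.mem_coe, mem_antidiagonal]
        refine Nat.eq_of_mul_eq_mul_right hd ?_
        simp only
        rw [mul_add, mul_add, ← hxy.1, ← hxy.2, hi.1, hi.2, hj.1, hj.2]
        ring
      · simp only [Prod.mk.injEq] at hi hj
        simp [hi, hj]
    · rintro ⟨i, j⟩ hij
      rw [← mem_antidiagonal.1 hij]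
      simp only [coeff_ray hd]
      ring
  · rw [coeff_ray_of_ne _ (by push Not at h; exact h), Finset.sum_eq_zero]
    rintro ⟨⟨x1, x2⟩, y1, y2⟩ hxy
    simp only [Finset.mem_product, mem_antidiagonal] at hxy
    refine hzero _ _ fun i j hi hj => h ⟨i + j, ?_⟩
    simp only [Prod.mk.injEq] at hi hj
    rw [← hxy.1, ← hxy.2, hi.1, hi.2, hj.1, hj.2, add_mul, add_mul]

theorem ray_pow {d : ℕ × ℕ} (hd : 0 < d.1 + d.2) (f : PowerSeries K) (k : ℕ) :
    ray γ d (f ^ k) = ray γ d f ^ k := by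
  induction k with
  | zero => rw [pow_zero, pow_zero, ray_one hd]
  | succ k ih => rw [pow_succ, pow_succ, ray_mul hd, ih]

theorem twist_ray {d : ℕ × ℕ} (hd : 0 < d.1 + d.2) (s t : K) (f : PowerSeries K) :
    twist s t (ray γ d f) = ray γ d (PowerSeries.rescale (s ^ d.1 * t ^ d.2) f) := by
  ext a b
  rw [coeff_twist]
  by_cases h : ∃ k, (a, b) = (k * d.1, k * d.2)
  · obtain ⟨k, hk⟩ := h
    obtain ⟨rfl, rfl⟩ := Prod.ext_iff.1 hk
    rw [coeff_ray hd, coeff_ray hd, PowerSeries.coeff_rescale]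
    ring
  · push Not at h
    rw [coeff_ray_of_ne _ h, coeff_ray_of_ne _ h, mul_zero]

theorem ofQP_qy {d : ℕ × ℕ} (hd : 0 < d.1 + d.2) :
    ofQP (qy γ 0 d.1 d.2) = ray γ d PowerSeries.X := by
  rw [ray_X hd]
  ext a b
  rw [map_smul, smul_eq_mul, coeff_mon, coeff_ofQP, qy]
  split_ifs
  · rw [zero_add, mul_one]
    norm_cast
  · rw [mul_zero]

theorem ofQP_qarg_qy {d : ℕ × ℕ} (hd : 0 < d.1 + d.2) (w : K) :
    ofQP (qarg γ w (qy γ 0 d.1 d.2)) = ray γ d (PowerSeries.dilogExponent w) := by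
  ext a b
  simp only [coeff_ofQP, qarg]
  simp only [← coeff_ofQP (γ := γ) (qpow _ _ _), ofQP_qpow, ofQP_qy hd, ← ray_pow hd]
  by_cases h : ∃ k, (a, b) = (k * d.1, k * d.2)
  · obtain ⟨k, hk⟩ := h
    obtain ⟨rfl, rfl⟩ := Prod.ext_iff.1 hk
    simp only [coeff_ray hd, PowerSeries.coeff_X_pow, PowerSeries.dilogExponent,
      PowerSeries.coeff_mk, mul_ite, mul_one, mul_zero, Finset.sum_ite_eq, Finset.mem_Icc]
    rcases Nat.eq_zero_or_pos k with rfl | hk0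
    · simp
    · rw [if_pos ⟨hk0, by rw [← mul_add]; exact Nat.le_mul_of_pos_right k hd⟩, mul_comm]
  · push Not at h
    simp [coeff_ray_of_ne _ h]

theorem ofQP_qPsi_qy {d : ℕ × ℕ} (hd : 0 < d.1 + d.2) (w : K) :
    ofQP (qPsi γ w (qy γ 0 d.1 d.2)) = ray γ d (PowerSeries.dilog w) := by
  ext a b
  simp only [coeff_ofQP, qPsi]
  simp only [← coeff_ofQP (γ := γ) (qpow _ _ _), ofQP_qpow, ofQP_qarg_qy hd, ← ray_pow hd]
  by_cases h : ∃ k, (a, b) = (k * d.1, k * d.2)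
  · obtain ⟨k, hk⟩ := h
    obtain ⟨rfl, rfl⟩ := Prod.ext_iff.1 hk
    have hN : k < k * d.1 + k * d.2 + 1 := by
      rw [← mul_add]; exact Nat.lt_succ_of_le (Nat.le_mul_of_pos_right k hd)
    simp only [coeff_ray hd]
    rw [PowerSeries.coeff_dilog w hN, Finset.mul_sum]
    exact Finset.sum_congr rfl fun _ _ => by ring
  · push Not at h
    simp [coeff_ray_of_ne _ h]

/-- Uniqueness of the solution of a `q`-difference equation in the first generator. -/
theorem eq_of_twist_eq {u f g : QuantumPlane γ} {s : K} (hs : ∀ n : ℕ, s ^ (n + 1) ≠ 1)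
    (hu : ∀ b, coeff (0, b) u = 0) (hf : twist s 1 f = (1 + u) * f)
    (hg : twist s 1 g = (1 + u) * g) (h0 : ∀ b, coeff (0, b) f = coeff (0, b) g) : f = g := by
  ext a b
  induction a using Nat.strong_induction_on generalizing b with
  | _ a ih =>
    rcases a with _ | a
    · exact h0 b
    · have hmul : coeff (a + 1, b) (u * f) = coeff (a + 1, b) (u * g) := by
        rw [coeff_mul, coeff_mul]
        refine Finset.sum_congr rfl fun x hx => Finset.sum_congr rfl fun y _ => ?_
        rcases Nat.eq_zero_or_pos x.1 with hx0 | hx0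
        · simp [hx0, hu]
        · rw [ih x.2 (by have := mem_antidiagonal.1 hx; omega)]
      have hf' := congrArg (coeff (a + 1, b)) hf
      have hg' := congrArg (coeff (a + 1, b)) hg
      rw [add_mul, one_mul, coeff_twist, map_add] at hf' hg'
      simp only [one_pow, mul_one] at hf' hg'
      refine mul_left_cancel₀ (sub_ne_zero.2 (hs a)) ?_
      linear_combination hf' - hg' + hmul

end QuantumPlane

theorem v_pow_succ_ne_one (n : ℕ) : v ^ (n + 1) ≠ 1 := by
  intro h
  have h' : algebraMap (Polynomial ℚ) (RatFunc ℚ) (Polynomial.X ^ (n + 1)) =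
      algebraMap (Polynomial ℚ) (RatFunc ℚ) 1 := by
    rw [map_pow, RatFunc.algebraMap_X, map_one]
    exact h
  have := congrArg Polynomial.natDegree (RatFunc.algebraMap_injective ℚ h')
  simp at this

theorem pow_ne_inv_pow {m : ℕ} (hm : 0 < m) (n : ℕ) :
    (v ^ m) ^ (n + 1) ≠ (v ^ m)⁻¹ ^ (n + 1) := by
  intro h
  obtain ⟨m, rfl⟩ := Nat.exists_eq_succ_of_ne_zero hm.ne'
  have hv : v ^ (m + 1) ≠ 0 := pow_ne_zero _ v_ne_zero
  refine v_pow_succ_ne_one (2 * ((m + 1) * (n + 1)) - 1) ?_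
  rw [Nat.sub_add_cancel (Nat.mul_pos two_pos (Nat.mul_pos m.succ_pos n.succ_pos)),
    two_mul, pow_add, pow_mul]
  nth_rewrite 1 [h]
  rw [← mul_pow, inv_mul_cancel₀ hv, one_pow]

theorem rescale_four_dilog_v : PowerSeries.rescale (v ^ 4) (PowerSeries.dilog v) =
    (1 + PowerSeries.C (v + v ^ 3) * PowerSeries.X +
      PowerSeries.C (v ^ 4) * PowerSeries.X ^ 2) * PowerSeries.dilog v := by
  have h := PowerSeries.rescale_sq_dilog (w := v) (by simpa using pow_ne_inv_pow one_pos)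
    v_ne_zero
  have h' := congrArg (PowerSeries.rescale (v ^ 2)) h
  have hC : PowerSeries.rescale (v ^ 2) (PowerSeries.C v) = PowerSeries.C v := by
    ext n
    rw [PowerSeries.coeff_rescale, PowerSeries.coeff_C]
    split_ifs with hn
    · rw [hn, pow_zero, one_mul]
    · rw [mul_zero]
  rw [PowerSeries.rescale_rescale, map_mul, h, map_add, map_one, map_mul, hC,
    PowerSeries.rescale_X, ← pow_add] at h'
  rw [show v ^ 4 = v ^ (2 + 2) from rfl, h']
  simp only [map_add, map_pow]
  ring

theorem rescale_four_dilog_v_sq : PowerSeries.rescale (v ^ 4) (PowerSeries.dilog (v ^ 2)) =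
    (1 + PowerSeries.C (v ^ 2) * PowerSeries.X) * PowerSeries.dilog (v ^ 2) := by
  rw [← PowerSeries.rescale_sq_dilog (pow_ne_inv_pow two_pos) (pow_ne_zero 2 v_ne_zero), ← pow_mul,
    show 2 * 2 = 4 from rfl]

namespace QuantumPlane

theorem ray_rescale_dilog_v {d : ℕ × ℕ} (hd : 0 < d.1 + d.2) :
    ray 2 d (PowerSeries.rescale (v ^ 4) (PowerSeries.dilog v)) =
      (1 + (v ^ (2 * d.1 * d.2) * (v + v ^ 3)) • mon d +
        (v ^ (4 * d.1 * d.2) * v ^ 4) • (mon d * mon d)) * ray 2 d (PowerSeries.dilog v) := by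
  rw [rescale_four_dilog_v, ray_mul hd, ray_add, ray_add, ray_one hd, ray_C_mul, ray_C_mul,
    ray_pow hd, ray_X hd, sq, smul_mul_smul_comm, smul_smul, smul_smul]
  ring_nf

theorem ray_rescale_dilog_v_sq {d : ℕ × ℕ} (hd : 0 < d.1 + d.2) :
    ray 2 d (PowerSeries.rescale (v ^ 4) (PowerSeries.dilog (v ^ 2))) =
      (1 + (v ^ (2 * d.1 * d.2) * v ^ 2) • mon d) * ray 2 d (PowerSeries.dilog (v ^ 2)) := by
  rw [rescale_four_dilog_v_sq, ray_mul hd, ray_add, ray_one hd, ray_C_mul, ray_X hd, smul_smul]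
  ring_nf

end QuantumPlane

namespace QuantumPlane

variable {γ : ℕ}

theorem coeff_zero_mul (f g : QuantumPlane γ) (b : ℕ) : coeff (0, b) (f * g) =
    ∑ y ∈ antidiagonal b, coeff (0, y.1) f * coeff (0, y.2) g := by
  rw [coeff_mul, Finset.Nat.antidiagonal_zero, Finset.sum_singleton]
  simp

theorem coeff_zero_mul_left {f : QuantumPlane γ}
    (hf : ∀ b, coeff (0, b) f = coeff (0, b) (1 : QuantumPlane γ)) (g : QuantumPlane γ) (b : ℕ) :
    coeff (0, b) (f * g) = coeff (0, b) g := by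
  rw [← one_mul g, ← mul_assoc, mul_one, coeff_zero_mul, coeff_zero_mul]
  simp only [hf]

theorem coeff_zero_mul_right {g : QuantumPlane γ}
    (hg : ∀ b, coeff (0, b) g = coeff (0, b) (1 : QuantumPlane γ)) (f : QuantumPlane γ) (b : ℕ) :
    coeff (0, b) (f * g) = coeff (0, b) f := by
  rw [← mul_one f, mul_assoc, one_mul, coeff_zero_mul, coeff_zero_mul]
  simp only [hg]

theorem coeff_zero_ray_dilog {d : ℕ × ℕ} (hd : 0 < d.1) (w : K) (b : ℕ) :
    coeff (0, b) (ray γ d (PowerSeries.dilog w)) = coeff (0, b) (1 : QuantumPlane γ) := by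
  have hd' : 0 < d.1 + d.2 := by omega
  rcases Nat.eq_zero_or_pos b with rfl | hb
  · have h := coeff_ray (γ := γ) hd' (PowerSeries.dilog w) 0
    rw [zero_mul, zero_mul, PowerSeries.coeff_zero_eq_constantCoeff_apply,
      PowerSeries.constantCoeff_dilog] at h
    rw [h, coeff_one]
    simp
  · rw [coeff_ray_of_ne, coeff_one, if_neg]
    · simp [hb.ne']
    · intro k hk
      simp only [Prod.mk.injEq] at hk
      have hk0 : k = 0 := by
        rcases Nat.mul_eq_zero.1 hk.1.symm with h | h
        · exact h
        · omega
      rw [hk0, zero_mul] at hk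
      exact hb.ne' (hk.2.trans (zero_mul _))

/-- The noncommutative computation showing that the right-hand side of the consistency relation
satisfies the same `q`-difference equation as the left-hand side. -/
theorem qDifference_of_commutation {F R : Type*} [CommRing F] [Ring R] [Module F R]
    [IsScalarTower F R R] [SMulCommClass F R R] {A A' B B' C C' D x y z : R} (q c : F)
    (hA : A' = A + q ^ 2 • (x * A)) (hB : B' = B + c • (y * B) + q ^ 8 • (y * y * B))
    (hC : C' = C + q ^ 6 • (z * C)) (hAy : A' * y = y * A) (hBz : B' * z = z * B)
    (hzA : z * A = A' * z + q ^ 6 • (x * (A' * z)))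
    (hAyy : A' * (y * y) = q ^ 4 • (x * (A' * z))) :
    A' * (B' * (C' * D)) =
      (1 + (q ^ 2 • x + c • y + q ^ 6 • z)) * (A * (B * (C * D))) := by
  set Q := B * (C * D) with hQ
  have h1 : B' * (C' * D) = Q + c • (y * Q) + q ^ 8 • (y * y * Q) + q ^ 6 • (z * Q) := by
    calc B' * (C' * D) = B' * (C * D) + q ^ 6 • (B' * z * (C * D)) := by
          rw [hC, add_mul, mul_add, smul_mul_assoc, mul_smul_comm]
          simp only [mul_assoc]
      _ = _ := by
          rw [hBz, hB]
          simp only [hQ, add_mul, smul_mul_assoc, mul_assoc]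
  calc A' * (B' * (C' * D)) = A' * Q + c • (A' * y * Q) + q ^ 8 • (A' * (y * y) * Q) +
        q ^ 6 • (A' * z * Q) := by
        rw [h1]
        simp only [mul_add, mul_smul_comm, mul_assoc]
    _ = A' * Q + c • (y * A * Q) + q ^ 6 • (z * A * Q) := by
        rw [hAyy, hAy, hzA]
        simp only [add_mul, smul_mul_assoc, smul_add]
        module
    _ = _ := by
        rw [hA]
        simp only [add_mul, one_mul, smul_mul_assoc, mul_assoc]
        module

theorem ray_mul_mon {d : ℕ × ℕ} (hd : 0 < d.1 + d.2) (f : PowerSeries K) (e : ℕ × ℕ) :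
    ray γ d f * mon e = mon e * ray γ d
      (PowerSeries.rescale ((v ^ (2 * γ * e.2))⁻¹ ^ d.1 * (v ^ (2 * γ * e.1)) ^ d.2) f) := by
  rw [mul_mon, twist_ray hd]

theorem consistency_left :
    twist (v ^ 4) 1 (ray 2 (0, 1) (PowerSeries.dilog v) *
        ray 2 (1, 0) (PowerSeries.dilog (v ^ 2))) =
      (1 + (v ^ 2 • mon (1, 0) + (v ^ 3 + v ^ 5) • mon (1, 1) + v ^ 6 • mon (1, 2))) *
        (ray 2 (0, 1) (PowerSeries.dilog v) * ray 2 (1, 0) (PowerSeries.dilog (v ^ 2))) := by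
  have hD : ray 2 (0, 1) (PowerSeries.dilog v) * mon (1, 0) =
      (mon (1, 0) + (v + v ^ 3) • mon (1, 1) + v ^ 4 • mon (1, 2)) *
        ray 2 (0, 1) (PowerSeries.dilog v) := by
    have h1 := ray_mul_mon (γ := 2) (d := (0, 1)) one_pos (PowerSeries.dilog v) (1, 0)
    have h2 := ray_rescale_dilog_v (d := (0, 1)) one_pos
    norm_num at h1 h2
    rw [h1, h2, ← mul_assoc]
    congr 1
    simp only [mul_add, mul_one, mul_smul_comm, mon_mul_mon]
    norm_num
  have hA := ray_rescale_dilog_v_sq (d := (1, 0)) one_pos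
  rw [twist_mul, twist_ray one_pos, twist_ray one_pos]
  norm_num at hA ⊢
  rw [hA, ← mul_assoc, mul_add, mul_one, mul_smul_comm, hD, ← mul_assoc]
  congr 1
  rw [← smul_mul_assoc, smul_add, smul_add, smul_smul, smul_smul,
    show v ^ 2 * (v + v ^ 3) = v ^ 3 + v ^ 5 by ring, ← pow_add, add_mul 1, one_mul]

theorem consistency_right :
    twist (v ^ 4) 1 (ray 2 (1, 0) (PowerSeries.dilog (v ^ 2)) *
        (ray 2 (1, 1) (PowerSeries.dilog v) * (ray 2 (1, 2) (PowerSeries.dilog (v ^ 2)) *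
          ray 2 (0, 1) (PowerSeries.dilog v)))) =
      (1 + (v ^ 2 • mon (1, 0) + (v ^ 3 + v ^ 5) • mon (1, 1) + v ^ 6 • mon (1, 2))) *
        (ray 2 (1, 0) (PowerSeries.dilog (v ^ 2)) *
        (ray 2 (1, 1) (PowerSeries.dilog v) * (ray 2 (1, 2) (PowerSeries.dilog (v ^ 2)) *
          ray 2 (0, 1) (PowerSeries.dilog v)))) := by
  have hv := v_ne_zero
  rw [twist_mul, twist_mul, twist_mul, twist_ray (d := (0, 1)) one_pos]
  have hD : PowerSeries.rescale ((v ^ 4) ^ 0 * 1 ^ 1) (PowerSeries.dilog v) =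
    PowerSeries.dilog v := by simp
  rw [hD]
  have hA : twist (v ^ 4) 1 (ray 2 (1, 0) (PowerSeries.dilog (v ^ 2))) =
      (1 + v ^ 2 • mon (1, 0)) * ray 2 (1, 0) (PowerSeries.dilog (v ^ 2)) := by
    have h := ray_rescale_dilog_v_sq (d := (1, 0)) one_pos
    rw [twist_ray one_pos]
    norm_num at h ⊢
    exact h
  refine qDifference_of_commutation v _ ?_ ?_ ?_ ?_ ?_ ?_ ?_
  · rw [hA, add_mul, one_mul, smul_mul_assoc]
  · have h := ray_rescale_dilog_v (d := (1, 1)) two_pos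
    rw [twist_ray two_pos]
    norm_num at h ⊢
    rw [h, add_mul, add_mul, one_mul, smul_mul_assoc, smul_mul_assoc, ← pow_add,
      show v ^ 2 * (v + v ^ 3) = v ^ 3 + v ^ 5 by ring]
  · have h := ray_rescale_dilog_v_sq (d := (1, 2)) three_pos
    rw [twist_ray three_pos]
    norm_num at h ⊢
    rw [h, add_mul, one_mul, smul_mul_assoc, ← pow_add]
  · rw [twist_ray one_pos, ray_mul_mon one_pos, PowerSeries.rescale_rescale]
    simp [v_ne_zero]
  · rw [twist_ray two_pos, ray_mul_mon two_pos, PowerSeries.rescale_rescale,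
      show _ * _ = (1 : K) by norm_num; field_simp, PowerSeries.rescale_one, RingHom.id_apply]
  · have h := ray_rescale_dilog_v_sq (d := (1, 0)) one_pos
    have h1 := congrArg (twist (v ^ 4) 1) h
    have htw : twist (v ^ 4) 1 (1 + v ^ 2 • mon (1, 0) : QuantumPlane 2) =
        1 + v ^ 6 • mon (1, 0) := by
      ext a b
      simp only [coeff_twist, map_add, map_smul, smul_eq_mul, coeff_one, coeff_mon, Prod.mk.injEq]
      by_cases ha0 : a = 0
      · simp [ha0]
      · by_cases ha1 : a = 1 <;> simp [ha0, ha1, ← pow_add]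
    have hmon := ray_mul_mon (γ := 2) (d := (1, 0)) one_pos
      (PowerSeries.rescale (v ^ 8) (PowerSeries.dilog (v ^ 2))) (1, 2)
    rw [PowerSeries.rescale_rescale] at hmon
    norm_num [hv, ← mul_pow] at h h1 hmon
    rw [twist_mul, htw, twist_ray one_pos, PowerSeries.rescale_rescale] at h1
    norm_num [← pow_add] at h1
    rw [← hmon, h1, add_mul, add_mul, one_mul, smul_mul_assoc, smul_mul_assoc, mul_assoc]
  · have hcomm : twist (v ^ 4) 1 (ray 2 (1, 0) (PowerSeries.dilog (v ^ 2))) * mon (1, 0) =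
        mon (1, 0) * twist (v ^ 4) 1 (ray 2 (1, 0) (PowerSeries.dilog (v ^ 2))) := by
      rw [twist_ray one_pos, ray_mul_mon one_pos]
      simp
    rw [← mul_assoc (mon (1, 0)), ← hcomm, mul_assoc, ← mul_smul_comm, mon_mul_mon, mon_mul_mon]
    simp

end QuantumPlane

/-- consistency relation of the type `B₂` QCSD: in `A₂`,
`Ψ_v(Y₂)·Ψ_{v²}(Y₁) = Ψ_{v²}(Y₁)·Ψ_v(y^{(1,1)})·Ψ_{v²}(y^{(1,2)})·Ψ_v(Y₂)`. -/
theorem B2_consistency :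
    qmul 2 (qPsi 2 v (qy 2 0 0 1)) (qPsi 2 (v ^ 2) (qy 2 0 1 0))
      = qmul 2 (qPsi 2 (v ^ 2) (qy 2 0 1 0))
          (qmul 2 (qPsi 2 v (qy 2 0 1 1))
            (qmul 2 (qPsi 2 (v ^ 2) (qy 2 0 1 2))
              (qPsi 2 v (qy 2 0 0 1)))) := by
  apply QuantumPlane.ofQP_injective (γ := 2)
  have hA := QuantumPlane.ofQP_qPsi_qy (γ := 2) (d := (1, 0)) one_pos (v ^ 2)
  have hB := QuantumPlane.ofQP_qPsi_qy (γ := 2) (d := (1, 1)) two_pos v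
  have hC := QuantumPlane.ofQP_qPsi_qy (γ := 2) (d := (1, 2)) three_pos (v ^ 2)
  have hD := QuantumPlane.ofQP_qPsi_qy (γ := 2) (d := (0, 1)) one_pos v
  simp only [QuantumPlane.ofQP_qmul, hA, hB, hC, hD]
  refine QuantumPlane.eq_of_twist_eq (s := v ^ 4) (fun n => ?_) (fun b => ?_)
    QuantumPlane.consistency_left QuantumPlane.consistency_right (fun b => ?_)
  · rw [← pow_mul]
    exact v_pow_succ_ne_one (4 * n + 3)
  · simp [QuantumPlane.coeff_mon]
  · rw [QuantumPlane.coeff_zero_mul_right (QuantumPlane.coeff_zero_ray_dilog one_pos _),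
      QuantumPlane.coeff_zero_mul_left (QuantumPlane.coeff_zero_ray_dilog one_pos _),
      QuantumPlane.coeff_zero_mul_left (QuantumPlane.coeff_zero_ray_dilog one_pos _),
      QuantumPlane.coeff_zero_mul_left (QuantumPlane.coeff_zero_ray_dilog one_pos _)]
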